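/- arXiv:2604.13782 — 2 statements merged into one kernel-verified Lean document; each statement's English description precedes it below -/
import Mathlib

section
/- Suppose x, y satisfy the semi-classical Meixner discrete system, and assume for every n ∈ ℤ that x(n) + y(n) ≠ 0, x(n) ≠ 0, y(n) ≠ c, x(n) − c n/(γ − 1) ≠ 0, c² x(n) + y(n)(c(γ + c − 1) − (γ − 1)y(n)) ≠ 0, a₀(n) + (p(n) + c) q(n) ≠ 0, 1 − q(n+1) ≠ 0 and c + p(n) − c q(n+1) ≠ 0. Then (q, p) satisfies the Sakai discrete Painlevé equation d-P(IV) with t = c in the special case a₂ = 1: for all n ∈ ℤ, q(n+1) = ((p(n) + c)/c)·(1 − (a₀(n) + a₁)/(a₀(n) + (p(n) + c) q(n))) and p(n+1) = (1/(1 − q(n+1)))·(1 + (a₀(n) + a₁) p(n)/(c + p(n) − c·q(n+1))). -/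
/-- `q(n) = (γ - 1) y(n)(y(n) - c)/(c²(x(n) + y(n)))`. -/
noncomputable def qC (γ c : ℂ) (x y : ℤ → ℂ) (n : ℤ) : ℂ :=
  (γ - 1) * y n * (y n - c) / (c ^ 2 * (x n + y n))

/-- `p(n) = c(x(n) + c)/(y(n) - c)
  + c²(γ + n)(x(n) + y(n))/(c² x(n) + y(n)(c(γ + c - 1) - (γ - 1) y(n)))`. -/
noncomputable def pC (γ c : ℂ) (x y : ℤ → ℂ) (n : ℤ) : ℂ :=
  c * (x n + c) / (y n - c)
    + c ^ 2 * (γ + (n : ℂ)) * (x n + y n)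
        / (c ^ 2 * x n + y n * (c * (γ + c - 1) - (γ - 1) * y n))

theorem meixner_aux (k c a b X Y q Q p P ν : ℂ) (hc : c ≠ 0) (hk : k ≠ 0)
    (h1 : (X + b) * (a + b) = k / c ^ 2 * b * (b - c) ^ 2)
    (h2 : (X + b) * (X + Y) = X * (X + c) ^ 2 / (X - c * (ν + 1) / k))
    (hs : a + b ≠ 0) (hu : b - c ≠ 0) (hU : Y - c ≠ 0) (hS : X + Y ≠ 0) (hX : X ≠ 0)
    (hB : X - c * (ν + 1) / k ≠ 0)
    (hD : c ^ 2 * a + b * (c * (k + 1 + c - 1) - (k + 1 - 1) * b) ≠ 0)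
    (hD' : c ^ 2 * X + Y * (c * (k + 1 + c - 1) - (k + 1 - 1) * Y) ≠ 0)
    (hA : ν + 1 + (p + c) * q ≠ 0) (hQ1 : 1 - Q ≠ 0) (hCP : c + p - c * Q ≠ 0)
    (hq : q = k * b * (b - c) / (c ^ 2 * (a + b)))
    (hQ : Q = k * Y * (Y - c) / (c ^ 2 * (X + Y)))
    (hp : p = c * (a + c) / (b - c) + c ^ 2 * (k + 1 + ν) * (a + b)
      / (c ^ 2 * a + b * (c * (k + 1 + c - 1) - (k + 1 - 1) * b)))
    (hP : P = c * (X + c) / (Y - c) + c ^ 2 * (k + 1 + (ν + 1)) * (X + Y)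
      / (c ^ 2 * X + Y * (c * (k + 1 + c - 1) - (k + 1 - 1) * Y))) :
    Q = (p + c) / c * (1 - (ν + 1 + (k + 1 - 1)) / (ν + 1 + (p + c) * q)) ∧
    P = 1 / (1 - Q) * (1 + (ν + 1 + (k + 1 - 1)) * p / (c + p - c * Q)) := by
  obtain ⟨m, rfl⟩ : ∃ m, ν = m - 1 - k := ⟨ν + 1 + k, by ring⟩
  obtain ⟨u, rfl⟩ : ∃ u, b = u + c := ⟨b - c, by ring⟩
  rw [add_sub_cancel_right] at hu h1 hq hp
  have hqs : c ^ 2 * q * (a + (u + c)) = k * (u + c) * u := by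
    rw [hq]; field_simp
  have hXq : X + (u + c) = q * u := by
    apply mul_right_cancel₀ hs
    rw [h1, hq]; field_simp
  have hDe : c ^ 2 * a + (u + c) * (c * (k + 1 + c - 1) - (k + 1 - 1) * (u + c))
      = c ^ 2 * (a + (u + c)) * (1 - q) := by linear_combination hqs
  have hq1 : 1 - q ≠ 0 := by
    intro h; rw [hDe, h] at hD; simp at hD
  have hq1' : q - 1 ≠ 0 := fun h => hq1 (by linear_combination -h)
  have hq0 : q ≠ 0 := by
    intro h
    rw [h] at hqs hXq
    have h3 : u + c = 0 := by
      have : k * (u + c) * u = 0 := by rw [← hqs]; ring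
      simpa [hk, hu] using this
    apply hX; linear_combination hXq - h3
  have hXe : X = (q - 1) * u - c := by linear_combination hXq
  have hQS : c ^ 2 * Q * (X + Y) = k * Y * (Y - c) := by
    rw [hQ]; field_simp
  have hDe' : c ^ 2 * X + Y * (c * (k + 1 + c - 1) - (k + 1 - 1) * Y)
      = c ^ 2 * (X + Y) * (1 - Q) := by linear_combination hQS
  -- normal forms
  have hpc : c * q * (q - 1) * (p + c) = k * (u + c) * (q - 1) - c * m * q := by
    rw [hDe] at hp
    have : p + c = c * (a + (u + c)) / u + m / (1 - q) := by
      rw [hp]; field_simp; ring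
    rw [this]; field_simp
    linear_combination (1 - q) * (q - 1) * hqs
  obtain ⟨B, hBd⟩ : ∃ B, B = k * (q - 1) * u - c * m := ⟨_, rfl⟩
  have hBX : X - c * (m - 1 - k + 1) / k = B / k := by
    rw [hBd, hXe]; field_simp; ring
  have hB0 : B ≠ 0 := by
    intro h; rw [hBX, h] at hB; simp at hB
  have hW : (X + Y) * (q * B) = k * X * (q - 1) ^ 2 * u := by
    rw [hBX, hXq] at h2
    have h3 : X + c = (q - 1) * u := by rw [hXe]; ring
    rw [h3] at h2
    field_simp at h2
    linear_combination h2
  obtain ⟨N, hN⟩ : ∃ N, N = c * m * q - k * (q - 1) * (u + c) := ⟨_, rfl⟩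
  have hYc : (Y - c) * (q * B) = (q - 1) * u * N := by
    have : (Y - c) * (q * B) = (X + Y) * (q * B) - (X + c) * (q * B) := by ring
    rw [this, hW, hBd, hN, hXe]; ring
  have hY : Y * (q * B) = X * (c * m * q - k * (q - 1) * u) := by
    have : Y * (q * B) = (X + Y) * (q * B) - X * (q * B) := by ring
    rw [this, hW, hBd]; ring
  have hN0 : N ≠ 0 := by
    intro h
    rw [h] at hYc
    simp [hU, hq0, hB0] at hYc
  have hQe : Q * (c ^ 2 * q * B * (q - 1)) = (c * m * q - k * (q - 1) * u) * N := by
    have hne : k * X * (q - 1) * u ≠ 0 := by simp [hk, hX, hq1', hu]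
    apply mul_right_cancel₀ hne
    calc Q * (c ^ 2 * q * B * (q - 1)) * (k * X * (q - 1) * u)
        = c ^ 2 * Q * (k * X * (q - 1) ^ 2 * u) * (q * B) := by ring
      _ = (c ^ 2 * Q * (X + Y)) * (q * B) * (q * B) := by rw [← hW]; ring
      _ = k * (Y * (q * B)) * ((Y - c) * (q * B)) := by rw [hQS]; ring
      _ = _ := by rw [hY, hYc]; ring
  have hpe : p + c = - N / (c * q * (q - 1)) := by
    field_simp; rw [hN]; linear_combination hpc
  have hQv : Q = (c * m * q - k * (q - 1) * u) * N / (c ^ 2 * q * B * (q - 1)) := by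
    field_simp; linear_combination hQe
  have hAe : m - 1 - k + 1 + (p + c) * q = B / (c * (q - 1)) := by
    rw [hpe, hN, hBd]; field_simp; ring
  have hCe : c + p - c * Q = - N * m / (q * B) := by
    have : c + p - c * Q = (p + c) - c * Q := by ring
    rw [this, hpe, hQv]; field_simp; rw [hBd]; ring
  have hm : m ≠ 0 := by
    intro h; rw [hCe, h] at hCP; simp at hCP
  constructor
  · rw [hAe, hpe, hQv]; field_simp; rw [hBd]; ring
  · have hP' : P = c * (q * B) / N + (m + 1) / (1 - Q) := by
      rw [hP, hDe']
      have e1 : c * (X + c) / (Y - c) = c * (q * B) / N := by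
        rw [div_eq_div_iff hU hN0]
        have h3 : X + c = (q - 1) * u := by rw [hXe]; ring
        rw [h3]; linear_combination -c * hYc
      rw [e1]; field_simp; ring
    have hpq : p = - N * m / (q * B) + c * Q - c := by rw [← hCe]; ring
    rw [hP', hCe, hpq]; field_simp; ring

/-- If `x, y` satisfy the semi-classical Meixner discrete system (with parameter `γ ≠ 1`
and `c ≠ 0`), then, under the stated nonvanishing assumptions, `(q, p)` satisfies the
Sakai discrete Painlevé equation d-P(IV) with `t = c` in the special case `a₂ = 1`, where
`a₀(n) = n + 1`, `a₁ = γ - 1`, `a₂ = 1`, `a₃(n) = -γ - n`. -/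
theorem semiclassicalMeixner_discrete_is_Sakai_dP_special
    (γ c : ℂ) (hc : c ≠ 0) (hγ : γ ≠ 1) (x y : ℤ → ℂ)
    (hsys1 : ∀ n : ℤ, (x (n + 1) + y n) * (x n + y n)
      = ((γ - 1) / c ^ 2) * y n * (y n - c) ^ 2)
    (hsys2 : ∀ n : ℤ, (x n + y (n - 1)) * (x n + y n)
      = x n * (x n + c) ^ 2 / (x n - c * (n : ℂ) / (γ - 1)))
    (hxy : ∀ n : ℤ, x n + y n ≠ 0) (hx0 : ∀ n : ℤ, x n ≠ 0)
    (hyc : ∀ n : ℤ, y n ≠ c)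
    (hxn : ∀ n : ℤ, x n - c * (n : ℂ) / (γ - 1) ≠ 0)
    (hd : ∀ n : ℤ, c ^ 2 * x n + y n * (c * (γ + c - 1) - (γ - 1) * y n) ≠ 0)
    (ha : ∀ n : ℤ, ((n : ℂ) + 1) + (pC γ c x y n + c) * qC γ c x y n ≠ 0)
    (hq1 : ∀ n : ℤ, 1 - qC γ c x y (n + 1) ≠ 0)
    (hcp : ∀ n : ℤ, c + pC γ c x y n - c * qC γ c x y (n + 1) ≠ 0) :
    ∀ n : ℤ,
      qC γ c x y (n + 1) = ((pC γ c x y n + c) / c)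
          * (1 - (((n : ℂ) + 1) + (γ - 1))
              / (((n : ℂ) + 1) + (pC γ c x y n + c) * qC γ c x y n))
      ∧ pC γ c x y (n + 1) = (1 / (1 - qC γ c x y (n + 1)))
          * (1 + (((n : ℂ) + 1) + (γ - 1)) * pC γ c x y n
              / (c + pC γ c x y n - c * qC γ c x y (n + 1))) := by
  intro n
  have hk : γ - 1 ≠ 0 := sub_ne_zero.mpr hγ
  have h1 := hsys1 n
  have h2 := hsys2 (n + 1)
  have hA := ha n
  have hQ1 := hq1 n
  have hCP := hcp n
  have hu := sub_ne_zero.mpr (hyc n)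
  have hU := sub_ne_zero.mpr (hyc (n + 1))
  have hs := hxy n
  have hS := hxy (n + 1)
  have hX := hx0 (n + 1)
  have hB := hxn (n + 1)
  have hD := hd n
  have hD' := hd (n + 1)
  have hqd : qC γ c x y n = (γ - 1) * y n * (y n - c) / (c ^ 2 * (x n + y n)) := rfl
  have hQd : qC γ c x y (n + 1) = (γ - 1) * y (n + 1) * (y (n + 1) - c)
      / (c ^ 2 * (x (n + 1) + y (n + 1))) := rfl
  have hpd : pC γ c x y n = c * (x n + c) / (y n - c)
    + c ^ 2 * (γ + (n : ℂ)) * (x n + y n)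
        / (c ^ 2 * x n + y n * (c * (γ + c - 1) - (γ - 1) * y n)) := rfl
  have hPd : pC γ c x y (n + 1) = c * (x (n + 1) + c) / (y (n + 1) - c)
    + c ^ 2 * (γ + ((n + 1 : ℤ) : ℂ)) * (x (n + 1) + y (n + 1))
        / (c ^ 2 * x (n + 1) + y (n + 1) * (c * (γ + c - 1) - (γ - 1) * y (n + 1))) := rfl
  rw [add_sub_cancel_right] at h2
  push_cast at h2 hB hPd
  generalize qC γ c x y n = q at *
  generalize qC γ c x y (n + 1) = Q at *
  generalize pC γ c x y n = p at *
  generalize pC γ c x y (n + 1) = P at *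
  generalize x (n + 1) = X at *
  generalize y (n + 1) = Y at *
  generalize x n = a at *
  generalize y n = b at *
  generalize (n : ℂ) = ν at *
  obtain ⟨k, rfl⟩ : ∃ k, γ = k + 1 := ⟨γ - 1, by ring⟩
  exact meixner_aux k c a b X Y q Q p P ν hc (by simpa using hk) (by simpa using h1)
    (by simpa using h2) hs hu hU hS hX (by simpa using hB) hD hD' hA hQ1 hCP (by simpa using hqd)
    (by simpa using hQd) hpd hPd
end

section
/- Set β_M = α_L + γ_L + n_L + 1, γ_M = γ_L + 1 and n_M = n_L, and define x(s) = s·g(s)/γ_L and y(s) = s·g(s)·(γ_L f(s) + (f(s) − 1)g(s) + n_L)/(γ_L(g(s) − n_L)). Let s₀ ∈ ℂ with s₀ ≠ 0, f(s₀) ≠ 0, g(s₀) ≠ 0, g(s₀) ≠ n_L and x(s₀) + y(s₀) ≠ 0. If f and g are differentiable at s₀ with derivatives satisfying the perturbed Laguerre differential system with parameters (α_L, γ_L, n_L) at s₀, then x and y are differentiable at s₀ and satisfy the generalised Meixner differential system with parameters (β_M, γ_M, n_M) at c = s₀. -/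
/-- `x(s) = s g(s)/γ_L`. -/
noncomputable def xM (γL : ℂ) (g : ℂ → ℂ) (s : ℂ) : ℂ := s * g s / γL

/-- `y(s) = s g(s)(γ_L f(s) + (f(s) - 1)g(s) + n_L)/(γ_L(g(s) - n_L))`. -/
noncomputable def yM (γL nL : ℂ) (f g : ℂ → ℂ) (s : ℂ) : ℂ :=
  s * g s * (γL * f s + (f s - 1) * g s + nL) / (γL * (g s - nL))

/-- With `β_M = α_L + γ_L + n_L + 1`, `γ_M = γ_L + 1`, `n_M = n_L`, if `f, g` are
differentiable at `s₀` with derivatives satisfying the perturbed Laguerre differential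
system with parameters `(α_L, γ_L, n_L)` there, then `x, y` are differentiable at `s₀`
and satisfy the generalised Meixner differential system with parameters
`(β_M, γ_M, n_M)` at `c = s₀`. -/
theorem perturbedLaguerre_to_generalisedMeixner_differential
    (αL γL nL βM γM nM : ℂ)
    (hβ : βM = αL + γL + nL + 1) (hγM : γM = γL + 1) (hnM : nM = nL)
    (hγ : γL ≠ 0) (f g : ℂ → ℂ) (s₀ : ℂ)
    (hs : s₀ ≠ 0) (hf : f s₀ ≠ 0) (hg0 : g s₀ ≠ 0) (hgn : g s₀ ≠ nL)
    (hxy : xM γL g s₀ + yM γL nL f g s₀ ≠ 0)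
    (hdf : HasDerivAt f
      (((γL + 2 * g s₀) * f s₀ ^ 2 - 4 * f s₀ * g s₀ + (αL - γL - s₀ + 2 * nL) * f s₀
          + 2 * g s₀ - αL - 2 * nL) / s₀) s₀)
    (hdg : HasDerivAt g
      ((g s₀ ^ 2 * (1 - f s₀ ^ 2) - (αL + 2 * nL + γL * f s₀ ^ 2) * g s₀
          + (αL + nL) * nL) / (s₀ * f s₀)) s₀) :
    HasDerivAt (xM γL g)
      (((nM + 1) * xM γL g s₀ + nM * yM γL nL f g s₀) / s₀
        - ((γM - 1) / s₀ ^ 2) * xM γL g s₀ * (xM γL g s₀ + yM γL nL f g s₀)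
        + xM γL g s₀ * (xM γL g s₀ + s₀) * (s₀ * (γM - βM) + (γM - 1) * xM γL g s₀)
            / (s₀ ^ 2 * (xM γL g s₀ + yM γL nL f g s₀))) s₀
    ∧ HasDerivAt (yM γL nL f g)
      (-xM γL g s₀ + yM γL nL f g s₀ / s₀
        + yM γL nL f g s₀ * (-1
            + (βM - 1) * (yM γL nL f g s₀ - s₀) / (s₀ * (xM γL g s₀ + yM γL nL f g s₀))
            + (γM - 1) * (yM γL nL f g s₀ - s₀) ^ 2
                / (s₀ ^ 2 * (xM γL g s₀ + yM γL nL f g s₀)))) s₀ := by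
  have hgn' : g s₀ - nL ≠ 0 := sub_ne_zero.mpr hgn
  have key : xM γL g s₀ + yM γL nL f g s₀
      = s₀ * g s₀ * f s₀ * (γL + g s₀) / (γL * (g s₀ - nL)) := by
    unfold xM yM
    field_simp
    ring
  have hγg : γL + g s₀ ≠ 0 := by
    intro h
    apply hxy
    rw [key, h]
    simp
  subst hβ hγM hnM
  rw [key]
  constructor
  · have h := ((hasDerivAt_id s₀).mul hdg).div_const γL
    refine HasDerivAt.congr_deriv (f := xM γL g) h ?_
    unfold xM yM
    simp only [id]
    field_simp
    ring
  · have h := (((hasDerivAt_id s₀).mul hdg).mul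
      (((hdf.const_mul γL).add ((hdf.sub_const 1).mul hdg)).add_const nM)).div
      ((hdg.sub_const nM).const_mul γL) (mul_ne_zero hγ hgn')
    refine HasDerivAt.congr_deriv (f := yM γL nM f g) h ?_
    unfold xM yM
    simp only [id, Pi.mul_apply, Pi.add_apply]
    field_simp
    ring
end
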